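/- Let k, n, M be positive integers with k > n. For each i ∈ {1,…,M}, let A_i : Finset (Finset (Fin k)) be a family of subsets of Fin k with |A_i| ≥ 2^(k−n). Let δ be a real number with 0 ≤ δ ≤ 1/2 such that the base-2 binary entropy of δ is at most (1/2)·(1 − n/k), i.e., Real.binEntropy δ ≤ ((1 − (n:ℝ)/k)/2) · Real.log 2. Then |Q(∏_{i=1}^M A_i)| ≥ (M+1)^(δ·k), where the right-hand side is a real power. -/

import Mathlib

/-- The sumset `Q(∏ᵢ Aᵢ)`: the set of all vectors `p : Fin k → ℕ` of the form
`p l = #{i : l ∈ aᵢ}` for some choice `aᵢ ∈ Aᵢ` (identifying `{0,1}^k` with the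
powerset of `Fin k`). -/
def Qset {k M : ℕ} (A : Fin M → Finset (Finset (Fin k))) : Finset (Fin k → ℕ) :=
  (Fintype.piFinset A).image fun a l => (Finset.univ.filter fun i => l ∈ a i).card

open Finset FinsetFamily in
theorem aux_erase_pres {α : Type*} [DecidableEq α] (a b : α) (A : Finset (Finset α))
    (h : ∀ s ∈ A, s.erase b ∈ A) : ∀ s ∈ 𝓓 a A, s.erase b ∈ 𝓓 a A := by
  intro s hs
  by_cases hab : a = b
  · subst hab
    exact Down.erase_mem_compression_of_mem_compression hs
  rw [Down.mem_compression] at hs ⊢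
  rcases hs with ⟨h1, h2⟩ | ⟨h1, h2⟩
  · left
    refine ⟨h s h1, ?_⟩
    rw [Finset.erase_right_comm]
    exact h _ h2
  · have has : a ∉ s := by
      intro has
      rw [Finset.insert_eq_of_mem has] at h2
      exact h1 h2
    have h3 : insert a (s.erase b) ∈ A := by
      have := h _ h2
      rwa [Finset.erase_insert_of_ne hab] at this
    by_cases h4 : s.erase b ∈ A
    · left
      refine ⟨h4, ?_⟩
      rwa [Finset.erase_eq_of_notMem (s := s.erase b) (a := a)]
      exact fun hh => has (Finset.mem_of_mem_erase hh)
    · right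
      exact ⟨h4, h3⟩

open Finset FinsetFamily in
theorem aux_compress {k M : ℕ} (A : Fin M → Finset (Finset (Fin k))) (a : Fin k) :
    (Qset (fun i => 𝓓 a (A i))).card ≤ (Qset A).card := by
  classical
  set π : (Fin k → ℕ) → (Fin k → ℕ) := fun p => Function.update p a 0 with hπ
  set I := (Qset (fun i => 𝓓 a (A i))).image π ∪ (Qset A).image π with hI
  rw [Finset.card_eq_sum_card_fiberwise (f := π) (t := I)
    (fun x hx => by
      simp only [hI, Finset.coe_union, Finset.coe_image]
      exact Or.inl ⟨x, hx, rfl⟩)]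
  rw [Finset.card_eq_sum_card_fiberwise (s := Qset A) (f := π) (t := I)
    (fun x hx => by
      simp only [hI, Finset.coe_union, Finset.coe_image]
      exact Or.inr ⟨x, hx, rfl⟩)]
  refine Finset.sum_le_sum fun x _ => ?_
  rcases Finset.eq_empty_or_nonempty
    ((Qset (fun i => 𝓓 a (A i))).filter (fun p => π p = x)) with he | hne
  · rw [he]; simp
  obtain ⟨p, hp, hmax⟩ := Finset.exists_max_image _ (fun p => p a) hne
  have h1 : ((Qset (fun i => 𝓓 a (A i))).filter (fun p => π p = x)).card
      ≤ (Finset.range (p a + 1)).card := by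
    refine Finset.card_le_card_of_injOn (fun q => q a) ?_ ?_
    · intro q hq
      have := hmax q hq
      simp only [Finset.coe_range, Set.mem_Iio]
      omega
    · intro q hq r hr hqr
      simp only [Finset.coe_filter, Set.mem_ofPred_eq] at hq hr
      have hqr' : π q = π r := hq.2.trans hr.2.symm
      funext l
      by_cases hl : l = a
      · subst hl; exact hqr
      · have := congrFun hqr' l
        simpa [hπ, hl] using this
  refine h1.trans ?_
  rw [Finset.mem_filter] at hp
  obtain ⟨hpQ, hpx⟩ := hp
  simp only [Qset, Finset.mem_image, Fintype.mem_piFinset] at hpQ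
  obtain ⟨d, hd, hdp⟩ := hpQ
  have hmem : ∀ i, a ∈ d i → d i ∈ A i ∧ (d i).erase a ∈ A i := by
    intro i hai
    rcases Down.mem_compression.1 (hd i) with h | ⟨h, h'⟩
    · exact h
    · rw [Finset.insert_eq_of_mem hai] at h'
      exact absurd h' h
  have hex : ∀ i, ∃ e ∈ A i, ∀ l, l ≠ a → (l ∈ e ↔ l ∈ d i) := by
    intro i
    rcases Down.mem_compression.1 (hd i) with ⟨h, _⟩ | ⟨_, h'⟩
    · exact ⟨_, h, fun _ _ => Iff.rfl⟩
    · exact ⟨_, h', fun l hl => by simp [hl]⟩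
  choose e heA hed using hex
  set J := Finset.univ.filter (fun i => a ∈ d i) with hJ
  have hJc : J.card = p a := by rw [← hdp]
  set m := (Finset.univ.filter (fun i => i ∉ J ∧ a ∈ e i)).card with hm
  refine Finset.card_le_card_of_injOn (fun j => Function.update x a (j + m)) ?_ ?_
  · intro j hj
    have hj' : j ≤ J.card := by
      simp only [Finset.coe_range, Set.mem_Iio] at hj
      omega
    obtain ⟨J', hJ', hJ'c⟩ := Finset.exists_subset_card_eq hj'
    simp only [Finset.coe_filter, Set.mem_ofPred_eq]
    refine ⟨?_, ?_⟩
    · simp only [Qset, Finset.mem_image, Fintype.mem_piFinset]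
      refine ⟨fun i => if i ∈ J then (if i ∈ J' then d i else (d i).erase a) else e i, ?_, ?_⟩
      · intro i
        dsimp only
        split_ifs with h1 h2
        · exact (hmem i (by simpa [hJ] using h1)).1
        · exact (hmem i (by simpa [hJ] using h1)).2
        · exact heA i
      · funext l
        by_cases hl : l = a
        · subst hl
          rw [Function.update_self, ← hJ'c, hm, ← Finset.card_union_of_disjoint]
          · congr 1
            ext i
            simp only [Finset.mem_filter, Finset.mem_univ, true_and, Finset.mem_union]
            by_cases h1 : i ∈ J
            · have h1' : l ∈ d i := by simpa [hJ] using h1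
              by_cases h2 : i ∈ J' <;> simp [h1, h2, h1']
            · have h2 : i ∉ J' := fun h => h1 (hJ' h)
              simp [h1, h2]
          · rw [Finset.disjoint_left]
            intro i hi hi'
            simp only [Finset.mem_filter, Finset.mem_univ, true_and] at hi'
            exact hi'.1 (hJ' hi)
        · rw [Function.update_of_ne hl, ← hpx, hπ]
          simp only [Function.update_of_ne hl]
          rw [← hdp]
          congr 1
          ext i
          simp only [Finset.mem_filter, Finset.mem_univ, true_and]
          split_ifs with h1 h2
          · rfl
          · simp [hl]
          · exact hed i l hl
    · rw [← hpx]
      simp [hπ]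
  · intro j _ j' _ h
    have := congrFun h a
    simpa using this

open Finset FinsetFamily in
theorem aux_down {k M : ℕ} (A : Fin M → Finset (Finset (Fin k))) (T : Finset (Fin k)) :
    ∃ D : Fin M → Finset (Finset (Fin k)), (∀ i, (D i).card = (A i).card) ∧
      (Qset D).card ≤ (Qset A).card ∧ ∀ i, ∀ b ∈ T, ∀ s ∈ D i, s.erase b ∈ D i := by
  classical
  induction T using Finset.induction_on with
  | empty => exact ⟨A, fun _ => rfl, le_rfl, by simp⟩
  | insert a T _ ih =>
    obtain ⟨D, h1, h2, h3⟩ := ih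
    refine ⟨fun i => 𝓓 a (D i), fun i => (Down.card_compression _ _).trans (h1 i),
      (aux_compress D a).trans h2, ?_⟩
    intro i b hb
    rcases Finset.mem_insert.1 hb with rfl | hb
    · intro s hs
      exact Down.erase_mem_compression_of_mem_compression hs
    · exact aux_erase_pres a b _ (h3 i b hb)

theorem aux_lower {k : ℕ} (D : Finset (Finset (Fin k)))
    (h : ∀ b, ∀ s ∈ D, s.erase b ∈ D) (s : Finset (Fin k)) (hs : s ∈ D)
    (t : Finset (Fin k)) (ht : t ⊆ s) : t ∈ D := by
  have key : ∀ u : Finset (Fin k), s \ u ∈ D := by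
    intro u
    induction u using Finset.induction_on with
    | empty => simpa using hs
    | insert a u _ ih =>
      rw [Finset.sdiff_insert]
      exact h _ _ ih
  have := key (s \ t)
  rwa [Finset.sdiff_sdiff_eq_self ht] at this

theorem aux_weight (k n : ℕ) (hkn : n < k) (A : Finset (Finset (Fin k)))
    (hA : 2 ^ (k - n) ≤ A.card) (δ : ℝ) (hδ0 : 0 ≤ δ) (hδhalf : δ ≤ 1 / 2)
    (hent : Real.binEntropy δ ≤ ((1 - (n : ℝ) / k) / 2) * Real.log 2) :
    ∃ s ∈ A, δ * k ≤ (s.card : ℝ) := by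
  by_contra! hcon
  have hk : (0 : ℝ) < k := by exact_mod_cast (by omega : 0 < k)
  have hne : A.Nonempty := by
    rw [← Finset.card_pos]
    exact lt_of_lt_of_le (by positivity) hA
  have hδ : 0 < δ := by
    rcases hδ0.lt_or_eq with h | h
    · exact h
    · obtain ⟨s, hs⟩ := hne
      have := hcon s hs
      rw [← h, zero_mul] at this
      exact absurd this (not_lt.2 (Nat.cast_nonneg _))
  have hδ1 : 0 < 1 - δ := by linarith
  have hlog : Real.log δ ≤ Real.log (1 - δ) := Real.log_le_log hδ (by linarith)
  have hterm : ∀ s ∈ A, Real.exp (-(k * Real.binEntropy δ)) ≤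
      δ ^ s.card * (1 - δ) ^ (k - s.card) := by
    intro s hs
    have hsk : s.card ≤ k := by simpa using Finset.card_le_univ s
    have h := hcon s hs
    rw [← Real.exp_log (show 0 < δ ^ s.card * (1 - δ) ^ (k - s.card) by positivity)]
    rw [Real.exp_le_exp, Real.log_mul (by positivity) (by positivity), Real.log_pow,
      Real.log_pow, Nat.cast_sub hsk, Real.binEntropy, Real.log_inv, Real.log_inv]
    nlinarith [mul_nonneg (sub_nonneg.2 h.le) (sub_nonneg.2 hlog)]
  have hsum : ∑ s ∈ A, δ ^ s.card * (1 - δ) ^ (k - s.card) ≤ 1 := by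
    have h1 := Finset.sum_pow_mul_eq_add_pow δ (1 - δ) (Finset.univ : Finset (Fin k))
    simp only [Finset.card_univ, Fintype.card_fin, add_sub_cancel, one_pow] at h1
    refine le_of_le_of_eq ?_ h1
    refine Finset.sum_le_sum_of_subset_of_nonneg (fun s _ => by simp) ?_
    intros; positivity
  have h2 : (A.card : ℝ) * Real.exp (-(k * Real.binEntropy δ)) ≤ 1 := by
    rw [← nsmul_eq_mul]
    exact (Finset.card_nsmul_le_sum _ _ _ hterm).trans hsum
  have h3 : (A.card : ℝ) ≤ Real.exp (k * Real.binEntropy δ) := by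
    rw [Real.exp_neg, ← div_eq_mul_inv, div_le_one (Real.exp_pos _)] at h2
    exact h2
  have h4 : ((2 : ℝ) ^ (k - n)) ≤ Real.exp (k * Real.binEntropy δ) :=
    le_trans (by exact_mod_cast hA) h3
  have h5 := Real.log_le_log (by positivity) h4
  rw [Real.log_exp, Real.log_pow, Nat.cast_sub hkn.le] at h5
  have h6 := mul_le_mul_of_nonneg_left hent hk.le
  have h7 : (k : ℝ) * (((1 - (n : ℝ) / k) / 2) * Real.log 2) = ((k - n) / 2) * Real.log 2 := by
    field_simp
  have h8 : (0 : ℝ) < k - n := by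
    have : (n : ℝ) < k := by exact_mod_cast hkn
    linarith
  have h9 := mul_pos h8 (Real.log_pos (by norm_num : (1 : ℝ) < 2))
  nlinarith

theorem aux_cubes {k M : ℕ} (D : Fin M → Finset (Finset (Fin k)))
    (S : Fin M → Finset (Fin k)) (h : ∀ i, ∀ t, t ⊆ S i → t ∈ D i) :
    ∏ l : Fin k, ((Finset.univ.filter fun i => l ∈ S i).card + 1) ≤ (Qset D).card := by
  classical
  have : ∏ l : Fin k, ((Finset.univ.filter fun i => l ∈ S i).card + 1) =
      (Fintype.piFinset fun l : Fin k =>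
        Finset.range ((Finset.univ.filter fun i => l ∈ S i).card + 1)).card := by
    simp
  rw [this]
  refine Finset.card_le_card fun p hp => ?_
  rw [Fintype.mem_piFinset] at hp
  have hT : ∀ l, ∃ T ⊆ (Finset.univ.filter fun i => l ∈ S i), T.card = p l := fun l =>
    Finset.exists_subset_card_eq (by have := Finset.mem_range.1 (hp l); omega)
  choose T hTs hTc using hT
  simp only [Qset, Finset.mem_image, Fintype.mem_piFinset]
  refine ⟨fun i => Finset.univ.filter fun l => i ∈ T l, fun i => h i _ ?_, ?_⟩
  · intro l hl
    have := hTs l (Finset.mem_filter.1 hl).2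
    exact (Finset.mem_filter.1 this).2
  · funext l
    rw [← hTc l]
    congr 1
    ext i
    simp

theorem stmt_10 (k n M : ℕ) (hn : 0 < n) (hkn : n < k) (hM : 0 < M)
    (A : Fin M → Finset (Finset (Fin k)))
    (hA : ∀ i, 2 ^ (k - n) ≤ (A i).card)
    (δ : ℝ) (hδ0 : 0 ≤ δ) (hδhalf : δ ≤ 1 / 2)
    (hent : Real.binEntropy δ ≤ ((1 - (n : ℝ) / k) / 2) * Real.log 2) :
    ((M : ℝ) + 1) ^ (δ * k) ≤ ((Qset A).card : ℝ) := by
  classical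
  obtain ⟨D, h1, h2, h3⟩ := aux_down A Finset.univ
  have hw : ∀ i, ∃ s ∈ D i, δ * k ≤ (s.card : ℝ) := fun i =>
    aux_weight k n hkn (D i) (by rw [h1]; exact hA i) δ hδ0 hδhalf hent
  choose S hSD hSc using hw
  have h4 := aux_cubes D S fun i t ht =>
    aux_lower (D i) (fun b => h3 i b (Finset.mem_univ _)) (S i) (hSD i) t ht
  have hM' : (0 : ℝ) < M := by exact_mod_cast hM
  set c : Fin k → ℕ := fun l => (Finset.univ.filter fun i => l ∈ S i).card with hc
  have hcM : ∀ l, c l ≤ M := fun l => by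
    simpa using Finset.card_le_univ (Finset.univ.filter fun i => l ∈ S i)
  have hsumc : ∑ l, c l = ∑ i, (S i).card := by
    simp only [hc, Finset.card_filter]
    rw [Finset.sum_comm]
    simp
  have h5 : δ * k ≤ ∑ l, (c l : ℝ) / M := by
    rw [← Finset.sum_div, le_div_iff₀ hM', ← Nat.cast_sum, hsumc, Nat.cast_sum]
    have := Finset.card_nsmul_le_sum Finset.univ (fun i => ((S i).card : ℝ)) (δ * k)
      (fun i _ => hSc i)
    simp only [Finset.card_univ, Fintype.card_fin, nsmul_eq_mul] at this
    linarith
  calc ((M : ℝ) + 1) ^ (δ * k) ≤ ((M : ℝ) + 1) ^ (∑ l, (c l : ℝ) / M) :=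
        Real.rpow_le_rpow_of_exponent_le (by linarith) h5
    _ = ∏ l, ((M : ℝ) + 1) ^ ((c l : ℝ) / M) :=
        Real.rpow_sum_of_pos (by linarith) _ _
    _ ≤ ∏ l, ((c l : ℝ) + 1) := by
        refine Finset.prod_le_prod (fun l _ => by positivity) fun l _ => ?_
        have := rpow_one_add_le_one_add_mul_self (s := (M : ℝ)) (by linarith)
          (p := (c l : ℝ) / M) (by positivity)
          (by rw [div_le_one hM']; exact_mod_cast hcM l)
        rw [div_mul_cancel₀ _ hM'.ne'] at this
        rw [add_comm (M : ℝ), add_comm (c l : ℝ)]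
        exact this
    _ ≤ ((Qset A).card : ℝ) := by exact_mod_cast h4.trans h2
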